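/- Let P : M₄(ℂ) → ℂ be a polynomial function of the 16 matrix entries such that P(gXhᵀ) = P(X) for all X ∈ M₄(ℂ) and all g, h ∈ SO₄(ℂ). Then there exists a polynomial Q in four variables with complex coefficients such that P(X) = Q(tr(XᵀX), tr((XᵀX)²), det X, tr((XᵀX)³)) for all X ∈ M₄(ℂ). In other words, the invariant ring ℂ[M₄(ℂ)]^{SO₄(ℂ)×SO₄(ℂ)} for the action (g,h)·X = gXhᵀ is generated by tr(XᵀX), tr((XᵀX)²), tr((XᵀX)³) and det X. -/

import Mathlib

open Matrix

theorem exists_diagonal_sign_det_mul_eq_one {n : Type*} [Fintype n] [DecidableEq n] [Nonempty n]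
    {R : Type*} [CommRing R] {U : Matrix n n R} (hU : Uᵀ * U = 1) :
    ∃ s : n → R, diagonal s * diagonal s = 1 ∧ (U * diagonal s).det = 1 := by
  obtain ⟨i⟩ := ‹Nonempty n›
  have hdet : U.det * U.det = 1 := by
    simpa using congrArg det hU
  refine ⟨Function.update 1 i U.det, ?_, ?_⟩
  · rw [diagonal_mul_diagonal, ← diagonal_one]
    congr 1
    ext j
    rcases eq_or_ne j i with rfl | hj
    · simpa using hdet
    · simp [hj]
  · rw [det_mul, det_diagonal, Finset.prod_update_of_mem (Finset.mem_univ i)]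
    simpa using hdet

theorem transpose_mul_self_mul_diagonal_sign {n : Type*} [Fintype n] [DecidableEq n]
    {R : Type*} [CommRing R] {U : Matrix n n R} (hU : Uᵀ * U = 1) {s : n → R}
    (hs : diagonal s * diagonal s = 1) :
    (U * diagonal s)ᵀ * (U * diagonal s) = 1 := by
  rw [transpose_mul, diagonal_transpose, Matrix.mul_assoc, ← Matrix.mul_assoc Uᵀ, hU,
    Matrix.one_mul, hs]

theorem exists_orthogonal_mul_diagonal_mul_transpose {n : Type*} [Fintype n] [DecidableEq n]
    {X : Matrix n n ℝ} (hX : X.det ≠ 0) :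
    ∃ (g h : Matrix n n ℝ) (d : n → ℝ),
      gᵀ * g = 1 ∧ hᵀ * h = 1 ∧ X = g * diagonal d * hᵀ := by
  have hpos : (Xᵀ * X).PosDef := by
    have := Matrix.PosDef.conjTranspose_mul_self X
      (Matrix.mulVec_injective_of_isUnit ((isUnit_iff_isUnit_det X).2 hX.isUnit))
    simpa using this
  have hH := hpos.isHermitian
  set U : Matrix n n ℝ := (hH.eigenvectorUnitary : Matrix n n ℝ)
  have hU : Uᵀ * U = 1 := by
    have := Unitary.coe_star_mul_self hH.eigenvectorUnitary
    simpa [star_eq_conjTranspose] using this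
  have hU' : U * Uᵀ = 1 := mul_eq_one_comm.1 hU
  have hspec : Xᵀ * X = U * diagonal hH.eigenvalues * Uᵀ := by
    have := hH.spectral_theorem
    rw [Unitary.conjStarAlgAut_apply] at this
    simpa [star_eq_conjTranspose] using this
  have hev := hpos.eigenvalues_pos
  refine ⟨X * U * diagonal (fun i => (√(hH.eigenvalues i))⁻¹), U,
    fun i => √(hH.eigenvalues i), ?_, hU, ?_⟩
  · have : ∀ a : Matrix n n ℝ, (X * U * a)ᵀ * (X * U * a) = aᵀ * (Uᵀ * (Xᵀ * X) * U) * a := by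
      intro a; simp only [transpose_mul, Matrix.mul_assoc]
    rw [this, congrArg (fun a => _ * (Uᵀ * a * U) * _) hspec]
    have : Uᵀ * (U * diagonal hH.eigenvalues * Uᵀ) * U
        = (Uᵀ * U) * diagonal hH.eigenvalues * (Uᵀ * U) := by simp only [Matrix.mul_assoc]
    rw [this, hU, Matrix.one_mul, Matrix.mul_one, diagonal_transpose, diagonal_mul_diagonal,
      diagonal_mul_diagonal, ← diagonal_one]
    congr 1
    ext i
    have h := Real.sqrt_pos.2 (hev i)
    field_simp
    exact (Real.sq_sqrt (hev i).le).symm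
  · rw [Matrix.mul_assoc (X * U), diagonal_mul_diagonal]
    have : (fun i => (√(hH.eigenvalues i))⁻¹ * √(hH.eigenvalues i)) = fun _ => (1 : ℝ) := by
      ext i
      exact inv_mul_cancel₀ (Real.sqrt_pos.2 (hev i)).ne'
    rw [this, diagonal_one, Matrix.mul_one, Matrix.mul_assoc, hU', Matrix.mul_one]

/-- **Singular value decomposition** of an invertible real matrix, with both orthogonal factors of
determinant one. -/
theorem exists_specialOrthogonal_mul_diagonal_mul_transpose {n : Type*} [Fintype n]
    [DecidableEq n] [Nonempty n] {X : Matrix n n ℝ} (hX : X.det ≠ 0) :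
    ∃ (g h : Matrix n n ℝ) (d : n → ℝ), gᵀ * g = 1 ∧ g.det = 1 ∧ hᵀ * h = 1 ∧ h.det = 1 ∧
      X = g * diagonal d * hᵀ := by
  obtain ⟨g, h, d, hg, hh, rfl⟩ := exists_orthogonal_mul_diagonal_mul_transpose hX
  obtain ⟨s, hs, hgs⟩ := exists_diagonal_sign_det_mul_eq_one hg
  obtain ⟨t, ht, hht⟩ := exists_diagonal_sign_det_mul_eq_one hh
  refine ⟨g * diagonal s, h * diagonal t, s * d * t, transpose_mul_self_mul_diagonal_sign hg hs,
    hgs, transpose_mul_self_mul_diagonal_sign hh ht, hht, ?_⟩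
  have hd : diagonal (s * d * t) = diagonal s * diagonal d * diagonal t := by
    simp only [diagonal_mul_diagonal]; rfl
  have : g * diagonal s * (diagonal s * diagonal d * diagonal t) * (h * diagonal t)ᵀ
      = g * (diagonal s * diagonal s) * diagonal d * (diagonal t * diagonal t) * hᵀ := by
    simp only [transpose_mul, diagonal_transpose, Matrix.mul_assoc]
  rw [hd, this, hs, ht, Matrix.mul_one, Matrix.mul_one]

theorem MvPolynomial.eq_of_eval_eq_of_real_det_ne_zero {n : Type*} [Fintype n] [DecidableEq n]
    {p q : MvPolynomial (n × n) ℂ}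
    (h : ∀ X : Matrix n n ℝ, X.det ≠ 0 →
      eval (fun i => (X i.1 i.2 : ℂ)) p = eval (fun i => (X i.1 i.2 : ℂ)) q) : p = q := by
  have hdet := det_mvPolynomialX_ne_zero n ℂ
  refine mul_left_cancel₀ hdet (funext_set (fun _ => Set.range ((↑) : ℝ → ℂ))
    (fun _ => Set.infinite_range_of_injective Complex.ofReal_injective) fun x hx => ?_)
  choose y hy using fun i => hx i trivial
  obtain rfl : (fun i => (y i : ℂ)) = x := _root_.funext hy
  rw [map_mul, map_mul, eval_det_mvPolynomialX]
  have hcast : (Matrix.of fun i j => (y (i, j) : ℂ)).det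
      = ((Matrix.of fun i j => y (i, j)).det : ℝ) :=
    (RingHom.map_det Complex.ofRealHom (Matrix.of fun i j => y (i, j))).symm
  rw [hcast]
  rcases eq_or_ne (Matrix.of fun i j => y (i, j)).det 0 with h0 | h0
  · simp [h0]
  · have h1 := h _ h0
    simp only [of_apply] at h1
    rw [h1]

namespace MvPolynomial

theorem exists_sum_sign_eval_eq (f : MvPolynomial (Fin 4) ℂ) :
    ∃ A B : MvPolynomial (Fin 4) ℂ, ∀ d : Fin 4 → ℂ,
      ∑ a ∈ ({1, -1} : Finset ℂ), ∑ b ∈ ({1, -1} : Finset ℂ), ∑ c ∈ ({1, -1} : Finset ℂ),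
        eval ![a * b * c * d 0, a * d 1, b * d 2, c * d 3] f
      = eval (fun i => d i ^ 2) A + (∏ i, d i) * eval (fun i => d i ^ 2) B := by
  induction f using MvPolynomial.induction_on' with
  | add p q hp hq =>
    obtain ⟨A, B, h⟩ := hp
    obtain ⟨A', B', h'⟩ := hq
    refine ⟨A + A', B + B', fun d => ?_⟩
    simp only [map_add, Finset.sum_add_distrib, h, h']
    ring
  | monomial m r =>
    have hne : (1 : ℂ) ≠ -1 := by norm_num
    obtain ⟨k, hk⟩ : ∃ k : Fin 4 → ℕ, ∀ i, m i = 2 * k i ∨ m i = 2 * k i + 1 :=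
      ⟨fun i => m i / 2, fun i => by lia⟩
    have hmon (x : Fin 4 → ℂ) : eval x (monomial m r)
        = r * (x 0 ^ m 0 * x 1 ^ m 1 * x 2 ^ m 2 * x 3 ^ m 3) := by
      rw [eval_monomial, Finsupp.prod_fintype _ _ (by simp), Fin.prod_univ_four]
    have heven (d : Fin 4 → ℂ) : eval (fun i => d i ^ 2) (C (8 * r) * ∏ i, X i ^ k i)
        = 8 * r * ((d 0 ^ 2) ^ k 0 * (d 1 ^ 2) ^ k 1 * (d 2 ^ 2) ^ k 2 * (d 3 ^ 2) ^ k 3) := by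
      simp [Fin.prod_univ_four]
    simp only [hmon, Finset.sum_pair hne]
    rcases hk 0 with h0 | h0 <;> rcases hk 1 with h1 | h1 <;>
      rcases hk 2 with h2 | h2 <;> rcases hk 3 with h3 | h3
    case inl.inl.inl.inl =>
      refine ⟨C (8 * r) * ∏ i, X i ^ k i, 0, fun d => ?_⟩
      rw [heven, h0, h1, h2, h3]
      simp [pow_mul]
      ring
    case inr.inr.inr.inr =>
      refine ⟨0, C (8 * r) * ∏ i, X i ^ k i, fun d => ?_⟩
      rw [heven, h0, h1, h2, h3]
      simp [pow_succ, pow_mul, Fin.prod_univ_four]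
      ring
    all_goals
      refine ⟨0, 0, fun d => ?_⟩
      rw [h0, h1, h2, h3]
      simp [pow_succ, pow_mul]
      try ring

theorem IsSymmetric.exists_eval_eq_psum {A : MvPolynomial (Fin 4) ℂ} (hA : A.IsSymmetric) :
    ∃ Q : MvPolynomial (Fin 4) ℂ, ∀ y : Fin 4 → ℂ,
      eval y A = eval ![∑ i, y i, ∑ i, y i ^ 2, ∏ i, y i, ∑ i, y i ^ 3] Q := by
  obtain ⟨B, hB⟩ := esymmAlgHom_fin_surjective ℂ (le_refl 4) ⟨A, hA⟩
  have hB' : A = bind₁ (fun i : Fin 4 => esymm (Fin 4) ℂ (i + 1)) B := by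
    have := esymmAlgHom_apply (σ := Fin 4) (R := ℂ) B
    rw [hB] at this
    exact this
  refine ⟨bind₁ ![X 0, MvPolynomial.C (1 / 2) * (X 0 ^ 2 - X 1),
    MvPolynomial.C (1 / 6) * (X 0 ^ 3 - 3 * X 0 * X 1 + 2 * X 3), X 2] B, fun y => ?_⟩
  have h2 : (Finset.powersetCard 2 (Finset.univ : Finset (Fin 4)))
      = {{0, 1}, {0, 2}, {0, 3}, {1, 2}, {1, 3}, {2, 3}} := by decide
  have h3 : (Finset.powersetCard 3 (Finset.univ : Finset (Fin 4)))
      = {{0, 1, 2}, {0, 1, 3}, {0, 2, 3}, {1, 2, 3}} := by decide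
  have h4 : (Finset.powersetCard 4 (Finset.univ : Finset (Fin 4))) = {Finset.univ} := by decide
  rw [hB']
  simp only [eval, eval₂Hom_bind₁]
  congr 2
  ext i
  fin_cases i
  · simp [esymm_one]
  · simp +decide [esymm, h2, Finset.sum_insert, Finset.prod_insert, Fin.sum_univ_four]
    ring
  · simp +decide [esymm, h3, Finset.sum_insert, Finset.prod_insert, Fin.sum_univ_four]
    ring
  · simp [esymm, h4]

theorem exists_isSymmetric_sum_perm (A : MvPolynomial (Fin 4) ℂ) :
    ∃ A' : MvPolynomial (Fin 4) ℂ, A'.IsSymmetric ∧ ∀ y : Fin 4 → ℂ,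
      ∑ σ : Equiv.Perm (Fin 4), eval (y ∘ σ) A = eval y A' := by
  refine ⟨∑ σ : Equiv.Perm (Fin 4), rename σ A, fun τ => ?_, fun y => ?_⟩
  · simp only [map_sum, rename_rename]
    exact Fintype.sum_equiv (Equiv.mulLeft τ) _ _ fun σ => rfl
  · simp [eval_rename]

/-- The invariants of the Weyl group of type `D₄` are generated by the power sums of degrees
`2`, `4`, `6` and the product of the variables. -/
theorem exists_eval_eq_of_perm_of_sign {f : MvPolynomial (Fin 4) ℂ}
    (hperm : ∀ (σ : Equiv.Perm (Fin 4)) (d : Fin 4 → ℂ), eval (d ∘ σ) f = eval d f)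
    (hsign : ∀ s d : Fin 4 → ℂ, (∀ i, s i ^ 2 = 1) → ∏ i, s i = 1 →
      eval (s * d) f = eval d f) :
    ∃ Q : MvPolynomial (Fin 4) ℂ, ∀ d : Fin 4 → ℂ,
      eval d f = eval ![∑ i, d i ^ 2, ∑ i, d i ^ 4, ∏ i, d i, ∑ i, d i ^ 6] Q := by
  obtain ⟨A, B, hAB⟩ := exists_sum_sign_eval_eq f
  have hAB' (d : Fin 4 → ℂ) :
      8 * eval d f = eval (fun i => d i ^ 2) A + (∏ i, d i) * eval (fun i => d i ^ 2) B := by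
    rw [← hAB]
    have hsum : ∀ a ∈ ({1, -1} : Finset ℂ), ∀ b ∈ ({1, -1} : Finset ℂ),
        ∀ c ∈ ({1, -1} : Finset ℂ),
        eval ![a * b * c * d 0, a * d 1, b * d 2, c * d 3] f = eval d f := by
      intro a ha b hb c hc
      have hsq : ∀ x ∈ ({1, -1} : Finset ℂ), x ^ 2 = 1 := by simp
      rw [← hsign ![a * b * c, a, b, c] d]
      · congr 2
        ext i
        fin_cases i <;> simp
      · intro i
        fin_cases i <;> simp [mul_pow, hsq a ha, hsq b hb, hsq c hc]
      · simp only [Fin.prod_univ_four, cons_val]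
        linear_combination (b ^ 2 * c ^ 2) * hsq a ha + c ^ 2 * hsq b hb + hsq c hc
    have hne : (1 : ℂ) ≠ -1 := by norm_num
    rw [Finset.sum_congr rfl fun a ha => Finset.sum_congr rfl fun b hb =>
      Finset.sum_congr rfl fun c hc => hsum a ha b hb c hc]
    simp only [Finset.sum_pair hne]
    ring
  obtain ⟨A', hA', hAA'⟩ := exists_isSymmetric_sum_perm A
  obtain ⟨B', hB', hBB'⟩ := exists_isSymmetric_sum_perm B
  obtain ⟨Q, hQ⟩ := hA'.exists_eval_eq_psum
  obtain ⟨R, hR⟩ := hB'.exists_eval_eq_psum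
  refine ⟨C (1 / 192) * (bind₁ ![X 0, X 1, X 2 ^ 2, X 3] Q
    + X 2 * bind₁ ![X 0, X 1, X 2 ^ 2, X 3] R), fun d => ?_⟩
  have hsub (S : MvPolynomial (Fin 4) ℂ) :
      eval ![∑ i, d i ^ 2, ∑ i, d i ^ 4, ∏ i, d i, ∑ i, d i ^ 6]
        (bind₁ ![X 0, X 1, X 2 ^ 2, X 3] S)
      = eval ![∑ i, d i ^ 2, ∑ i, (d i ^ 2) ^ 2, ∏ i, d i ^ 2, ∑ i, (d i ^ 2) ^ 3] S := by
    simp only [eval, eval₂Hom_bind₁]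
    congr 2
    ext i
    fin_cases i <;> simp [← pow_mul, Finset.prod_pow]
  have key : 192 * eval d f
      = eval (fun i => d i ^ 2) A' + (∏ i, d i) * eval (fun i => d i ^ 2) B' := by
    have hterm (σ : Equiv.Perm (Fin 4)) : 8 * eval d f
        = eval ((fun i => d i ^ 2) ∘ σ) A + (∏ i, d i) * eval ((fun i => d i ^ 2) ∘ σ) B := by
      rw [← hperm σ d, hAB', ← Equiv.prod_comp σ d]
      rfl
    calc 192 * eval d f = ∑ σ : Equiv.Perm (Fin 4), 8 * eval d f := by
          rw [Finset.sum_const, Finset.card_univ, Fintype.card_perm, Fintype.card_fin]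
          norm_num [Nat.factorial, ← mul_assoc]
      _ = _ := by
          rw [Finset.sum_congr rfl fun σ _ => hterm σ, Finset.sum_add_distrib, ← Finset.mul_sum,
            hAA', hBB']
  rw [map_mul, map_add, map_mul, hsub, hsub, ← hQ, ← hR, eval_C, eval_X]
  simp only [cons_val]
  rw [← key]
  ring

end MvPolynomial

theorem exists_specialOrthogonal_conj_diagonal_eq_diagonal_comp {n : Type*} [Fintype n]
    [DecidableEq n] [Nonempty n] {R : Type*} [CommRing R] (σ : Equiv.Perm n) :
    ∃ g : Matrix n n R, gᵀ * g = 1 ∧ g.det = 1 ∧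
      ∀ d : n → R, g * diagonal d * gᵀ = diagonal (d ∘ σ) := by
  have hU : (σ.permMatrix R)ᵀ * σ.permMatrix R = 1 := by
    rw [transpose_permMatrix, ← permMatrix_mul, mul_inv_cancel, permMatrix_one]
  obtain ⟨s, hs, hdet⟩ := exists_diagonal_sign_det_mul_eq_one hU
  refine ⟨σ.permMatrix R * diagonal s, transpose_mul_self_mul_diagonal_sign hU hs, hdet,
    fun d => ?_⟩
  have hcomm : diagonal s * diagonal d * diagonal s = diagonal d := by
    rw [diagonal_mul_diagonal, diagonal_mul_diagonal, ← Matrix.mul_one (diagonal d), ← hs,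
      diagonal_mul_diagonal, diagonal_mul_diagonal]
    congr 1
    ext i
    ring
  have : σ.permMatrix R * diagonal s * diagonal d * (σ.permMatrix R * diagonal s)ᵀ
      = σ.permMatrix R * (diagonal s * diagonal d * diagonal s) * (σ.permMatrix R)ᵀ := by
    simp only [transpose_mul, diagonal_transpose, Matrix.mul_assoc]
  rw [this, hcomm, transpose_permMatrix, Equiv.Perm.permMatrix, PEquiv.toMatrix_toPEquiv_mul,
    Equiv.Perm.permMatrix, PEquiv.mul_toMatrix_toPEquiv]
  ext i j
  simp [diagonal_apply, Equiv.Perm.inv_def]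

theorem trace_transpose_mul_self_pow_orthogonal {n : Type*} [Fintype n] [DecidableEq n]
    {R : Type*} [CommRing R] {g h : Matrix n n R} (hg : gᵀ * g = 1) (hh : hᵀ * h = 1)
    (X : Matrix n n R) (k : ℕ) :
    (((g * X * hᵀ)ᵀ * (g * X * hᵀ)) ^ k).trace = ((Xᵀ * X) ^ k).trace := by
  have h1 : (g * X * hᵀ)ᵀ * (g * X * hᵀ) = h * (Xᵀ * X) * hᵀ := by
    have : (g * X * hᵀ)ᵀ * (g * X * hᵀ) = h * (Xᵀ * (gᵀ * g) * X) * hᵀ := by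
      simp only [transpose_mul, transpose_transpose, Matrix.mul_assoc]
    rw [this, hg, Matrix.mul_one]
  have h2 : (h * (Xᵀ * X) * hᵀ) ^ k = h * (Xᵀ * X) ^ k * hᵀ := by
    induction k with
    | zero => rw [pow_zero, pow_zero, Matrix.mul_one, mul_eq_one_comm.1 hh]
    | succ k ih =>
      have : h * (Xᵀ * X) ^ k * hᵀ * (h * (Xᵀ * X) * hᵀ)
          = h * ((Xᵀ * X) ^ k * (hᵀ * h) * (Xᵀ * X)) * hᵀ := by simp only [Matrix.mul_assoc]
      rw [pow_succ, ih, this, hh, Matrix.mul_one, ← pow_succ]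
  rw [h1, h2, trace_mul_comm, ← Matrix.mul_assoc, hh, Matrix.one_mul]

theorem trace_transpose_mul_self_pow_diagonal {n : Type*} [Fintype n] [DecidableEq n]
    {R : Type*} [CommRing R] (d : n → R) (k : ℕ) :
    (((diagonal d)ᵀ * diagonal d) ^ k).trace = ∑ i, d i ^ (2 * k) := by
  rw [diagonal_transpose, diagonal_mul_diagonal, diagonal_pow, trace_diagonal]
  simp [← pow_two, ← pow_mul]

theorem eval_trace_transpose_mul_self_pow_mvPolynomialX {n : Type*} [Fintype n] [DecidableEq n]
    {R : Type*} [CommRing R] (X : Matrix n n R) (k : ℕ) :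
    MvPolynomial.eval (fun p => X p.1 p.2)
      (((mvPolynomialX n n R)ᵀ * mvPolynomialX n n R) ^ k).trace = ((Xᵀ * X) ^ k).trace := by
  have hmap (G : MvPolynomial (n × n) R →+* R) (M : Matrix n n (MvPolynomial (n × n) R)) :
      G ((Mᵀ * M) ^ k).trace = (((G.mapMatrix M)ᵀ * G.mapMatrix M) ^ k).trace := by
    have htrans : (G.mapMatrix M)ᵀ = G.mapMatrix Mᵀ := rfl
    rw [htrans, ← map_mul, ← map_pow]
    exact AddMonoidHom.map_trace G _
  rw [hmap, mvPolynomialX_mapMatrix_eval]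

/-- If `P : M₄(ℂ) → ℂ` is a polynomial function of the 16 matrix entries that is invariant
under the action `(g,h)·X = gXhᵀ` of `SO₄(ℂ) × SO₄(ℂ)`, then `P` is a polynomial in
`tr(XᵀX)`, `tr((XᵀX)²)`, `det X` and `tr((XᵀX)³)`. -/
theorem statement7 (P : Matrix (Fin 4) (Fin 4) ℂ → ℂ)
    (hpoly : ∃ q : MvPolynomial (Fin 4 × Fin 4) ℂ,
      ∀ X : Matrix (Fin 4) (Fin 4) ℂ, P X = MvPolynomial.eval (fun p => X p.1 p.2) q)
    (hinv : ∀ (X g h : Matrix (Fin 4) (Fin 4) ℂ),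
      gᵀ * g = 1 → g.det = 1 → hᵀ * h = 1 → h.det = 1 → P (g * X * hᵀ) = P X) :
    ∃ Q : MvPolynomial (Fin 4) ℂ, ∀ X : Matrix (Fin 4) (Fin 4) ℂ,
      P X = MvPolynomial.eval
        ![(Xᵀ * X).trace, ((Xᵀ * X) ^ 2).trace, X.det, ((Xᵀ * X) ^ 3).trace] Q := by
  obtain ⟨q, hq⟩ := hpoly
  let f : MvPolynomial (Fin 4) ℂ :=
    MvPolynomial.bind₁ (fun p => diagonal MvPolynomial.X p.1 p.2) q
  have hf (d : Fin 4 → ℂ) : MvPolynomial.eval d f = P (diagonal d) := by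
    simp only [f, hq, MvPolynomial.eval, MvPolynomial.eval₂Hom_bind₁]
    congr 2
    ext p
    by_cases hp : p.1 = p.2
    · simp [hp]
    · simp [diagonal_apply_ne _ hp]
  obtain ⟨Q, hQ⟩ := MvPolynomial.exists_eval_eq_of_perm_of_sign (f := f)
    (fun σ d => by
      obtain ⟨g, hg, hdet, hconj⟩ :=
        exists_specialOrthogonal_conj_diagonal_eq_diagonal_comp (R := ℂ) σ
      rw [hf, hf, ← hconj, hinv _ g g hg hdet hg hdet])
    (fun s d hs hprod => by
      have hs' : (diagonal s)ᵀ * diagonal s = 1 := by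
        rw [diagonal_transpose, diagonal_mul_diagonal, ← diagonal_one]
        congr 1
        ext i
        rw [← pow_two, hs]
      rw [hf, hf, ← hinv (diagonal d) (diagonal s) 1 hs' (by rw [det_diagonal, hprod])
        (by simp) (by simp)]
      simp only [transpose_one, Matrix.mul_one, diagonal_mul_diagonal]
      rfl)
  let M := mvPolynomialX (Fin 4) (Fin 4) ℂ
  let r : MvPolynomial (Fin 4 × Fin 4) ℂ :=
    MvPolynomial.bind₁ ![((Mᵀ * M) ^ 1).trace, ((Mᵀ * M) ^ 2).trace, M.det,
      ((Mᵀ * M) ^ 3).trace] Q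
  have hr (X : Matrix (Fin 4) (Fin 4) ℂ) : MvPolynomial.eval (fun p => X p.1 p.2) r
      = MvPolynomial.eval ![((Xᵀ * X) ^ 1).trace, ((Xᵀ * X) ^ 2).trace, X.det,
        ((Xᵀ * X) ^ 3).trace] Q := by
    simp only [r, MvPolynomial.eval, MvPolynomial.eval₂Hom_bind₁]
    congr 2
    ext i
    fin_cases i
    · exact eval_trace_transpose_mul_self_pow_mvPolynomialX X 1
    · exact eval_trace_transpose_mul_self_pow_mvPolynomialX X 2
    · exact eval_det_mvPolynomialX _ _ fun p => X p.1 p.2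
    · exact eval_trace_transpose_mul_self_pow_mvPolynomialX X 3
  suffices hqr : q = r by
    refine ⟨Q, fun X => ?_⟩
    rw [hq, hqr, hr, pow_one]
  refine MvPolynomial.eq_of_eval_eq_of_real_det_ne_zero fun X hX => ?_
  obtain ⟨g, h, d, hg, hgdet, hh, hhdet, rfl⟩ :=
    exists_specialOrthogonal_mul_diagonal_mul_transpose hX
  let φ := Complex.ofRealHom.mapMatrix (m := Fin 4)
  have horth {u : Matrix (Fin 4) (Fin 4) ℝ} (hu : uᵀ * u = 1) : (φ u)ᵀ * φ u = 1 := by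
    rw [show (φ u)ᵀ = φ uᵀ from rfl, ← map_mul, hu, map_one]
  have hdet {u : Matrix (Fin 4) (Fin 4) ℝ} (hu : u.det = 1) : (φ u).det = 1 := by
    rw [← RingHom.map_det, hu, map_one]
  have hφ : φ (g * diagonal d * hᵀ) = φ g * diagonal (fun i => (d i : ℂ)) * (φ h)ᵀ := by
    rw [map_mul, map_mul, show (φ h)ᵀ = φ hᵀ from rfl]
    congr 2
    exact diagonal_map (map_zero Complex.ofRealHom)
  change MvPolynomial.eval (fun p => φ (g * diagonal d * hᵀ) p.1 p.2) q
    = MvPolynomial.eval (fun p => φ (g * diagonal d * hᵀ) p.1 p.2) r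
  rw [hr, ← hq, hφ, hinv _ _ _ (horth hg) (hdet hgdet) (horth hh) (hdet hhdet), ← hf, hQ]
  simp only [trace_transpose_mul_self_pow_orthogonal (horth hg) (horth hh),
    trace_transpose_mul_self_pow_diagonal, det_mul, det_transpose, hdet hgdet, hdet hhdet,
    det_diagonal, one_mul, mul_one, Nat.reduceMul]
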